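/- Let U, β ∈ ℝ and α ≠ 0, and define φ : ℝ → ℝ by φ(w) = U − β + (U/α − U + 2β)·exp(w/α). Then for every w ∈ [0,1], ∫₀^w φ(u) du + β·w + (1 − w)·U = α·(φ(w) − β). -/

import Mathlib

open Real intervalIntegral

theorem ocs_min_threshold_integral_identity
    (U β α : ℝ) (hα : α ≠ 0)
    (φ : ℝ → ℝ)
    (hφ : ∀ w, φ w = U - β + (U / α - U + 2 * β) * Real.exp (w / α)) :
    ∀ w ∈ Set.Icc (0 : ℝ) 1,
      (∫ u in (0 : ℝ)..w, φ u) + β * w + (1 - w) * U = α * (φ w - β) := by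
  intro w _
  have hderiv : ∀ x ∈ Set.uIcc (0 : ℝ) w,
      HasDerivAt (fun u => (U - β) * u + α * (U / α - U + 2 * β) * Real.exp (u / α)) (φ x) x := by
    intro x _
    have h := ((hasDerivAt_id x).const_mul (U - β)).add
      ((((hasDerivAt_id x).div_const α).exp).const_mul (α * (U / α - U + 2 * β)))
    refine h.congr_deriv ?_
    rw [hφ]
    simp only [id]
    field_simp
  have hcont : Continuous φ := by
    rw [funext hφ]
    fun_prop
  rw [integral_eq_sub_of_hasDerivAt hderiv (hcont.intervalIntegrable 0 w), hφ]
  simp only [zero_div, Real.exp_zero]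
  field_simp
  ring
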